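/- Fix an integer k ≥ 1 and consider the fair k-sided positive-step die with face values 1, 2, …, k, each with probability 1/k; let E(n) be the expected duration until the running total first reaches ≥ n. Then E(n) − ( 2n/(k+1) + 2(k−1)/(3(k+1)) ) tends to 0 as n → ∞. -/

import Mathlib

/-- The sum of the first `j` steps of the word `w` (face values given by `v`). -/
def prefSumN {s k : ℕ} (v : Fin s → ℕ) (w : Fin k → Fin s) (j : ℕ) : ℕ :=
  ∑ i ∈ Finset.univ.filter (fun i : Fin k => (i : ℕ) < j), v (w i)

/-- The first-passage probability `P_n(k')`: the probability that the running total of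
rolls of the die (face values `v`, probabilities `p`) first reaches `≥ n` at exactly
roll `k'`. -/
noncomputable def firstPassage {s : ℕ} (v : Fin s → ℕ) (p : Fin s → ℝ) (n k : ℕ) : ℝ :=
  ∑ w ∈ Finset.univ.filter (fun w : Fin k → Fin s =>
      n ≤ prefSumN v w k ∧ ∀ j : ℕ, j < k → prefSumN v w j < n),
    ∏ i : Fin k, p (w i)

/-- The expected duration `E(n) = Σ_{k'=1}^n k' · P_n(k')` until first reaching `≥ n`. -/
noncomputable def expDur {s : ℕ} (v : Fin s → ℕ) (p : Fin s → ℝ) (n : ℕ) : ℝ :=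
  ∑ k ∈ Finset.Icc 1 n, (k : ℝ) * firstPassage v p n k

theorem prefSumN_zero {s k : ℕ} (v : Fin s → ℕ) (w : Fin k → Fin s) : prefSumN v w 0 = 0 := by
  simp [prefSumN]

theorem prefSumN_cons_succ {s k : ℕ} (v : Fin s → ℕ) (a : Fin s) (w : Fin k → Fin s) (j : ℕ) :
    prefSumN v (Fin.cons a w : Fin (k + 1) → Fin s) (j + 1) = v a + prefSumN v w j := by
  simp [prefSumN, Finset.sum_filter, Fin.sum_univ_succ]

/-- First-step decomposition of the first-passage probability. The subtraction is truncated. -/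
theorem firstPassage_succ {s : ℕ} (v : Fin s → ℕ) (p : Fin s → ℝ) {n : ℕ} (hn : 1 ≤ n) (k : ℕ) :
    firstPassage v p n (k + 1) = ∑ a, p a * firstPassage v p (n - v a) k := by
  have hcond (a : Fin s) (w : Fin k → Fin s) :
      (n ≤ prefSumN v (Fin.cons a w : Fin (k + 1) → Fin s) (k + 1) ∧
        ∀ j < k + 1, prefSumN v (Fin.cons a w : Fin (k + 1) → Fin s) j < n) ↔
      (n - v a ≤ prefSumN v w k ∧ ∀ j < k, prefSumN v w j < n - v a) := by
    rw [prefSumN_cons_succ]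
    refine and_congr (by omega) ⟨fun h j hj => ?_, fun h j hj => ?_⟩
    · have := h (j + 1) (by omega)
      rw [prefSumN_cons_succ] at this
      omega
    · cases j with
      | zero => rw [prefSumN_zero]; omega
      | succ j =>
        have := h j (by omega)
        rw [prefSumN_cons_succ]
        omega
  simp only [firstPassage, Finset.sum_filter]
  rw [← (Fin.consEquiv (fun _ : Fin (k + 1) => Fin s)).sum_comp, Fintype.sum_prod_type]
  refine Finset.sum_congr rfl fun a _ => ?_
  rw [Finset.mul_sum]
  refine Finset.sum_congr rfl fun w _ => ?_
  simp only [Fin.consEquiv, Equiv.coe_fn_mk, hcond, Fin.prod_univ_succ, Fin.cons_zero,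
    Fin.cons_succ, mul_ite, mul_zero]

theorem firstPassage_zero_left {s : ℕ} (v : Fin s → ℕ) (p : Fin s → ℝ) {k : ℕ} (hk : 1 ≤ k) :
    firstPassage v p 0 k = 0 := by
  rw [firstPassage, Finset.filter_eq_empty_iff.2, Finset.sum_empty]
  rintro w - ⟨-, h⟩
  exact absurd (h 0 hk) (by simp)

theorem firstPassage_zero_zero {s : ℕ} (v : Fin s → ℕ) (p : Fin s → ℝ) :
    firstPassage v p 0 0 = 1 := by
  simp [firstPassage]

theorem firstPassage_zero_right {s : ℕ} (v : Fin s → ℕ) (p : Fin s → ℝ) {n : ℕ} (hn : 1 ≤ n) :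
    firstPassage v p n 0 = 0 := by
  rw [firstPassage, Finset.filter_eq_empty_iff.2, Finset.sum_empty]
  rintro w - ⟨h, -⟩
  rw [prefSumN_zero] at h
  omega

theorem firstPassage_eq_zero {s : ℕ} (v : Fin s → ℕ) (p : Fin s → ℝ) (hv : ∀ a, 1 ≤ v a)
    {n k : ℕ} (h : n < k) : firstPassage v p n k = 0 := by
  induction k generalizing n with
  | zero => omega
  | succ k ih =>
    rcases Nat.eq_zero_or_pos n with rfl | hn
    · exact firstPassage_zero_left v p h
    · rw [firstPassage_succ v p hn]
      refine Finset.sum_eq_zero fun a _ => ?_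
      rw [ih (by have := hv a; omega), mul_zero]

theorem sum_firstPassage {s : ℕ} (v : Fin s → ℕ) (p : Fin s → ℝ) (hv : ∀ a, 1 ≤ v a)
    (hp : ∑ a, p a = 1) {n N : ℕ} (h : n < N) :
    ∑ k ∈ Finset.range N, firstPassage v p n k = 1 := by
  induction N generalizing n with
  | zero => omega
  | succ N ih =>
    rw [Finset.sum_range_succ']
    rcases Nat.eq_zero_or_pos n with rfl | hn
    · rw [firstPassage_zero_zero, Finset.sum_eq_zero, zero_add]
      exact fun k _ => firstPassage_zero_left v p (by omega)
    · simp only [firstPassage_succ v p hn, firstPassage_zero_right v p hn, add_zero]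
      rw [Finset.sum_comm, ← hp]
      refine Finset.sum_congr rfl fun a _ => ?_
      rw [← Finset.mul_sum, ih (by have := hv a; omega), mul_one]

theorem expDur_eq_sum_range {s : ℕ} (v : Fin s → ℕ) (p : Fin s → ℝ) (hv : ∀ a, 1 ≤ v a)
    {n N : ℕ} (h : n < N) :
    expDur v p n = ∑ k ∈ Finset.range N, (k : ℝ) * firstPassage v p n k := by
  refine Finset.sum_subset (fun k hk => ?_) fun k _ hk => ?_
  · simp only [Finset.mem_Icc, Finset.mem_range] at *
    omega
  · rw [Finset.mem_Icc] at hk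
    rcases Nat.eq_zero_or_pos k with rfl | hk0
    · simp
    · rw [firstPassage_eq_zero v p hv (by omega), mul_zero]

theorem expDur_zero {s : ℕ} (v : Fin s → ℕ) (p : Fin s → ℝ) : expDur v p 0 = 0 := by
  simp [expDur]

/-- The renewal equation for the expected duration. The subtraction is truncated. -/
theorem expDur_eq {s : ℕ} (v : Fin s → ℕ) (p : Fin s → ℝ) (hv : ∀ a, 1 ≤ v a)
    (hp : ∑ a, p a = 1) {n : ℕ} (hn : 1 ≤ n) :
    expDur v p n = ∑ a, p a * (expDur v p (n - v a) + 1) := by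
  rw [expDur_eq_sum_range v p hv (Nat.lt_succ_self n), Finset.sum_range_succ']
  simp only [firstPassage_succ v p hn, Nat.cast_zero, zero_mul, add_zero, Finset.mul_sum]
  rw [Finset.sum_comm]
  refine Finset.sum_congr rfl fun a _ => ?_
  have ha : n - v a < n := by have := hv a; omega
  rw [expDur_eq_sum_range v p hv ha, ← sum_firstPassage v p hv hp ha, ← Finset.sum_add_distrib,
    Finset.mul_sum]
  refine Finset.sum_congr rfl fun k _ => ?_
  push_cast
  ring

theorem sum_range_cast_add_one (m : ℕ) :
    ∑ i ∈ Finset.range m, ((i : ℝ) + 1) = m * (m + 1) / 2 := by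
  induction m with
  | zero => simp
  | succ m ih => rw [Finset.sum_range_succ, ih]; push_cast; ring

theorem sum_range_cast_add_one_mul (m : ℕ) :
    ∑ i ∈ Finset.range m, ((i : ℝ) + 1) * i = (m - 1) * m * (m + 1) / 3 := by
  induction m with
  | zero => simp
  | succ m ih => rw [Finset.sum_range_succ, ih]; push_cast; ring

/-- The weighted sum `∑ (i + 1) a (n + i)` is conserved by the moving-average recursion. -/
theorem weighted_sum_of_moving_average {k : ℕ} {a : ℕ → ℝ}
    (ha : ∀ n, k * a (n + k) = ∑ i ∈ Finset.range k, a (n + i)) (n : ℕ) :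
    ∑ i ∈ Finset.range k, ((i : ℝ) + 1) * a (n + i) =
      ∑ i ∈ Finset.range k, ((i : ℝ) + 1) * a i := by
  induction n with
  | zero => simp
  | succ n ih =>
    rw [← ih]
    have h₁ := Finset.sum_range_succ (fun i => (i : ℝ) * a (n + i)) k
    rw [Finset.sum_range_succ', ha n] at h₁
    simp only [Nat.cast_zero, zero_mul, add_zero, Nat.cast_add, Nat.cast_one] at h₁
    simp only [add_mul, one_mul, Finset.sum_add_distrib] at h₁ ⊢
    simpa only [add_assoc, add_comm 1] using h₁

/-- A sequence satisfying the moving-average recursion whose conserved weighted sum vanishes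
tends to zero. -/
theorem tendsto_zero_of_moving_average {k : ℕ} (hk : 1 ≤ k) {a : ℕ → ℝ}
    (ha : ∀ n, k * a (n + k) = ∑ i ∈ Finset.range k, a (n + i))
    (h0 : ∑ i ∈ Finset.range k, ((i : ℝ) + 1) * a i = 0) :
    Filter.Tendsto a Filter.atTop (nhds 0) := by
  have hk0 : (1 : ℝ) ≤ k := by exact_mod_cast hk
  set B := ∑ i ∈ Finset.range k, |a i|
  have hB0 : 0 ≤ B := Finset.sum_nonneg fun _ _ => abs_nonneg _
  have hbound (n : ℕ) : |a n| ≤ B * (1 / 2) ^ (n / k) := by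
    induction n using Nat.strong_induction_on with
    | _ n ih =>
    rcases lt_or_ge n k with hn | hn
    · rw [Nat.div_eq_of_lt hn, pow_zero, mul_one]
      exact Finset.single_le_sum (f := fun i => |a i|) (fun _ _ => abs_nonneg _)
        (Finset.mem_range.2 hn)
    · obtain ⟨m, rfl⟩ := Nat.exists_eq_add_of_le' hn
      have hcomb : (k : ℝ) ^ 2 * a (m + k) =
          ∑ i ∈ Finset.range k, ((k : ℝ) - (i + 1)) * a (m + i) := by
        simp only [sub_mul, Finset.sum_sub_distrib]
        rw [weighted_sum_of_moving_average ha, h0, ← Finset.mul_sum, ← ha]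
        ring
      have hle : (k : ℝ) ^ 2 * |a (m + k)| ≤
          ∑ i ∈ Finset.range k, ((k : ℝ) - (i + 1)) * (B * (1 / 2) ^ (m / k)) := by
        rw [← abs_of_nonneg (sq_nonneg (k : ℝ)), ← abs_mul, hcomb]
        refine (Finset.abs_sum_le_sum_abs _ _).trans (Finset.sum_le_sum fun i hi => ?_)
        have hi' := Finset.mem_range.1 hi
        have hik : (0 : ℝ) ≤ (k : ℝ) - (i + 1) := by
          have : ((i + 1 : ℕ) : ℝ) ≤ k := by exact_mod_cast hi'
          push_cast at this
          linarith
        rw [abs_mul, abs_of_nonneg hik]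
        refine mul_le_mul_of_nonneg_left ((ih (m + i) (by omega)).trans ?_) hik
        refine mul_le_mul_of_nonneg_left ?_ hB0
        exact pow_le_pow_of_le_one (by norm_num) (by norm_num)
          (Nat.div_le_div_right (Nat.le_add_right m i))
      rw [← Finset.sum_mul, Finset.sum_sub_distrib, sum_range_cast_add_one, Finset.sum_const,
        Finset.card_range, nsmul_eq_mul] at hle
      rw [Nat.add_div_right m hk, pow_succ]
      have hX : 0 ≤ B * (1 / 2) ^ (m / k) := by positivity
      refine le_of_mul_le_mul_left (hle.trans ?_) (by positivity : (0 : ℝ) < (k : ℝ) ^ 2)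
      nlinarith [mul_nonneg (by linarith : (0 : ℝ) ≤ k) hX]
  refine squeeze_zero_norm hbound ?_
  have h := (tendsto_pow_atTop_nhds_zero_of_lt_one (r := (1 / 2 : ℝ)) (by norm_num)
    (by norm_num)).comp (Nat.tendsto_div_const_atTop (by omega : k ≠ 0))
  simpa using h.const_mul B

/-- For the fair k-sided die with faces 1, …, k each of probability 1/k,
the expected duration `E(n)` satisfies
`E(n) − (2n/(k+1) + 2(k−1)/(3(k+1))) → 0` as `n → ∞`. -/
theorem expected_duration_fair_die (k : ℕ) (hk : 1 ≤ k) :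
    Filter.Tendsto
      (fun n : ℕ => expDur (fun j : Fin k => (j : ℕ) + 1) (fun _ => 1 / (k : ℝ)) n -
        (2 * (n : ℝ) / ((k : ℝ) + 1) + 2 * ((k : ℝ) - 1) / (3 * ((k : ℝ) + 1))))
      Filter.atTop (nhds 0) := by
  obtain ⟨K, rfl⟩ := Nat.exists_eq_add_of_le' hk
  have hK : ((K : ℝ) + 1) ≠ 0 := by positivity
  set f := expDur (fun j : Fin (K + 1) => (j : ℕ) + 1) (fun _ => 1 / ((K + 1 : ℕ) : ℝ)) with hf
  have hrec (n : ℕ) : ((K : ℝ) + 1) * f (n + 1) =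
      ∑ i ∈ Finset.range (K + 1), f (n + i - K) + (K + 1) := by
    have h := expDur_eq (fun j : Fin (K + 1) => (j : ℕ) + 1) (fun _ => 1 / ((K + 1 : ℕ) : ℝ))
      (fun _ => Nat.le_add_left _ _) (by simp [hK]) (Nat.le_add_left 1 n)
    rw [← hf, ← Finset.mul_sum,
      Fin.sum_univ_eq_sum_range (fun j => f (n + 1 - (j + 1)) + 1) (K + 1),
      ← Finset.sum_range_reflect, Finset.sum_add_distrib] at h
    rw [h]
    have hs : ∑ j ∈ Finset.range (K + 1), f (n + 1 - (K + 1 - 1 - j + 1)) =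
        ∑ i ∈ Finset.range (K + 1), f (n + i - K) := by
      refine Finset.sum_congr rfl fun i hi => ?_
      have := Finset.mem_range.1 hi
      congr 1
      omega
    rw [hs]
    push_cast
    simp only [Finset.sum_const, Finset.card_range, nsmul_eq_mul]
    push_cast
    field_simp
  let a : ℕ → ℝ := fun n =>
    f (n - K) - (2 * ((n : ℝ) - K) / (K + 1 + 1) + 2 * K / (3 * (K + 1 + 1)))
  have hsum : ∑ i ∈ Finset.range (K + 1), (i : ℝ) = K * (K + 1) / 2 := by
    have := sum_range_cast_add_one K
    rw [Finset.sum_range_succ', Nat.cast_zero, add_zero, ← this]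
    simp
  have ha : Filter.Tendsto a Filter.atTop (nhds 0) := by
    refine tendsto_zero_of_moving_average hk (fun n => ?_) ?_
    · have h1 : n + (K + 1) - K = n + 1 := by omega
      simp only [a, h1, Finset.sum_sub_distrib, Finset.sum_add_distrib, ← Finset.sum_div,
        ← Finset.mul_sum, Nat.cast_add, Nat.cast_one, hsum, mul_sub, hrec,
        Finset.sum_const, Finset.card_range, nsmul_eq_mul]
      field_simp
      ring
    · have h1 : ∀ i ∈ Finset.range (K + 1), ((i : ℝ) + 1) * a i =
          -(2 / (K + 1 + 1)) * (((i : ℝ) + 1) * i) +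
            (2 * K / (K + 1 + 1) - 2 * K / (3 * (K + 1 + 1))) * ((i : ℝ) + 1) := by
        intro i hi
        have hi0 : i - K = 0 := by have := Finset.mem_range.1 hi; omega
        simp only [a, hi0, hf, expDur_zero]
        ring
      rw [Finset.sum_congr rfl h1, Finset.sum_add_distrib, ← Finset.mul_sum, ← Finset.mul_sum,
        sum_range_cast_add_one, sum_range_cast_add_one_mul]
      push_cast
      field_simp
      ring
  refine (ha.comp (Filter.tendsto_add_atTop_nat K)).congr fun n => ?_
  simp only [Function.comp_apply, a, Nat.add_sub_cancel, Nat.cast_add, Nat.cast_one,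
    add_sub_cancel_right]
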